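/- Let (D₁, D₂, D₃, c, g₁, g₂, g₃, ξ) be a BKL datum satisfying the BKL constraints. Let A, B : ℝ³ → ℝ be smooth with A > 0 and B > 0 everywhere, and let σ ∈ {−1, +1}. For a smooth function f write B^f for the function exp(f · log B). Define ĝ_i = A g_i for i = 1,2,3; D̂₁ = σ A B^{g₂+g₃} D₁, D̂₂ = σ A B^{g₃+g₁} D₂, D̂₃ = σ A B^{g₁+g₂} D₃; and ξ̂ = ξ + log A + (g₁+g₂+g₃) log B. Then D̂₁, D̂₂, D̂₃ is again a frame, and (D̂₁, D̂₂, D̂₃, ĉ, ĝ₁, ĝ₂, ĝ₃, ξ̂), with ĉ its structure functions, is a BKL datum satisfying the BKL constraints. -/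

import Mathlib

noncomputable section

/-- Points of `ℝ³`. -/
abbrev R3 : Type := Fin 3 → ℝ

/-- Lie bracket of vector fields on `ℝ³`:
`[X,Y](x) = (DY)_x(X(x)) − (DX)_x(Y(x))`. -/
def lieB (X Y : R3 → R3) : R3 → R3 :=
  fun x => fderiv ℝ Y x (X x) - fderiv ℝ X x (Y x)

/-- Directional derivative `X(f)(x) = (Df)_x(X(x))`. -/
def dirD (X : R3 → R3) (f : R3 → ℝ) : R3 → ℝ :=
  fun x => fderiv ℝ f x (X x)

/-- A frame: three smooth vector fields, linearly independent at every point. -/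
def IsFrame (D : Fin 3 → R3 → R3) : Prop :=
  (∀ i, ContDiff ℝ (⊤ : ℕ∞) (D i)) ∧ ∀ x : R3, LinearIndependent ℝ fun i => D i x

/-- `c` is the family of (smooth) structure functions of the frame `D`:
`[D j, D k] = ∑ i, c j k i • D i`.  Here `c j k i` stands for `c_{jk}^i`. -/
def IsStructFns (D : Fin 3 → R3 → R3) (c : Fin 3 → Fin 3 → Fin 3 → R3 → ℝ) : Prop :=
  (∀ j k i, ContDiff ℝ (⊤ : ℕ∞) (c j k i)) ∧
    ∀ j k, ∀ x : R3, lieB (D j) (D k) x = ∑ i, c j k i x • D i x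

/-- `(i,j,k)` is a cyclic permutation of `(1,2,3)` (as indices `(0,1,2)`). -/
def Cyclic (i j k : Fin 3) : Prop :=
  (i, j, k) = (0, 1, 2) ∨ (i, j, k) = (1, 2, 0) ∨ (i, j, k) = (2, 0, 1)

/-- The BKL constraint equations for the datum `(D, c, g, ξ)`. -/
def BKLConstraints (D : Fin 3 → R3 → R3) (c : Fin 3 → Fin 3 → Fin 3 → R3 → ℝ)
    (g : Fin 3 → R3 → ℝ) (ξ : R3 → ℝ) : Prop :=
  (∀ x : R3, g 1 x * g 2 x + g 2 x * g 0 x + g 0 x * g 1 x = 0) ∧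
    ∀ i j k : Fin 3, Cyclic i j k → ∀ x : R3,
      dirD (D i) (fun y => g j y + g k y) x + c i j j x * (g i x - g j x)
        + c i k k x * (g i x - g k x) - 2 * dirD (D i) ξ x * g i x = 0

/-- Smoothness of the functions in a BKL datum. -/
def SmoothDatum (g : Fin 3 → R3 → ℝ) (ξ : R3 → ℝ) : Prop :=
  (∀ i, ContDiff ℝ (⊤ : ℕ∞) (g i)) ∧ ContDiff ℝ (⊤ : ℕ∞) ξ

/-- `B^f = exp (f · log B)`. -/
def bpow (B f : R3 → ℝ) : R3 → ℝ := fun x => Real.exp (f x * Real.log (B x))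

/-- The transformed frame `D̂ i = σ A B^(g j + g k) • D i`, `(i,j,k)` cyclic. -/
def confFrame (D : Fin 3 → R3 → R3) (g : Fin 3 → R3 → ℝ) (A B : R3 → ℝ) (σ : ℝ) :
    Fin 3 → R3 → R3 :=
  fun i x => (σ * A x * bpow B (fun y => g (i + 1) y + g (i + 2) y) x) • D i x


theorem lieB_smul {X Y : R3 → R3} {φ ψ : R3 → ℝ} {x : R3}
    (hX : DifferentiableAt ℝ X x) (hY : DifferentiableAt ℝ Y x)
    (hφ : DifferentiableAt ℝ φ x) (hψ : DifferentiableAt ℝ ψ x) :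
    lieB (fun y => φ y • X y) (fun y => ψ y • Y y) x =
      (φ x * ψ x) • lieB X Y x + (φ x * dirD X ψ x) • Y x - (ψ x * dirD Y φ x) • X x := by
  simp only [lieB, dirD]
  rw [fderiv_fun_smul hψ hY, fderiv_fun_smul hφ hX]
  simp only [add_apply, smul_apply, map_smul,
    ContinuousLinearMap.smulRight_apply]
  module

theorem structFns_smul_diag {D : Fin 3 → R3 → R3} {c chat : Fin 3 → Fin 3 → Fin 3 → R3 → ℝ}
    {φ : Fin 3 → R3 → ℝ} (hD : IsFrame D) (hc : IsStructFns D c)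
    (hφ : ∀ i, Differentiable ℝ (φ i))
    (hchat : IsStructFns (fun i x => φ i x • D i x) chat) {i j : Fin 3} (hij : i ≠ j) (x : R3) :
    chat i j j x * φ j x = φ i x * φ j x * c i j j x + φ i x * dirD (D i) (φ j) x := by
  have hdiff (i) : DifferentiableAt ℝ (D i) x := (hD.1 i).differentiable (by simp) x
  have key := hchat.2 i j x
  rw [lieB_smul (hdiff i) (hdiff j) (hφ i x) (hφ j x), hc.2 i j x] at key
  have hsum : ∑ m, (chat i j m x * φ m x - φ i x * φ j x * c i j m x
      - (if m = j then φ i x * dirD (D i) (φ j) x else 0)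
      + (if m = i then φ j x * dirD (D j) (φ i) x else 0)) • D m x = 0 := by
    simp only [add_smul, sub_smul, Finset.sum_add_distrib, Finset.sum_sub_distrib, ite_smul,
      zero_smul, Finset.sum_ite_eq', Finset.mem_univ, if_true, mul_smul (chat i j _ x), ← key,
      mul_smul _ (c i j _ x), ← Finset.smul_sum]
    abel
  have h := Fintype.linearIndependent_iff.1 (hD.2 x) _ hsum j
  simp only [if_true, if_neg hij.symm] at h
  linarith

theorem dirD_add {X : R3 → R3} {u v : R3 → ℝ} {x : R3}
    (hu : DifferentiableAt ℝ u x) (hv : DifferentiableAt ℝ v x) :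
    dirD X (fun y => u y + v y) x = dirD X u x + dirD X v x := by
  simp [dirD, fderiv_fun_add hu hv]

theorem dirD_mul {X : R3 → R3} {u v : R3 → ℝ} {x : R3}
    (hu : DifferentiableAt ℝ u x) (hv : DifferentiableAt ℝ v x) :
    dirD X (fun y => u y * v y) x = u x * dirD X v x + v x * dirD X u x := by
  simp [dirD, fderiv_fun_mul hu hv]

theorem dirD_const_mul {X : R3 → R3} {u : R3 → ℝ} {x : R3} (a : ℝ)
    (hu : DifferentiableAt ℝ u x) : dirD X (fun y => a * u y) x = a * dirD X u x := by
  simp [dirD, fderiv_const_mul hu]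

theorem dirD_exp {X : R3 → R3} {u : R3 → ℝ} {x : R3} (hu : DifferentiableAt ℝ u x) :
    dirD X (fun y => Real.exp (u y)) x = Real.exp (u x) * dirD X u x := by
  simp [dirD, fderiv_exp hu]

theorem dirD_smul (φ u : R3 → ℝ) (X : R3 → R3) (x : R3) :
    dirD (fun y => φ y • X y) u x = φ x * dirD X u x := by
  simp [dirD]

/-- The logarithmic derivative of `σ A B^f`, with `A = exp a` and `B = exp b`. -/
theorem dirD_conf_factor {X : R3 → R3} {a b f : R3 → ℝ} {x : R3} (σ : ℝ)
    (ha : DifferentiableAt ℝ a x) (hb : DifferentiableAt ℝ b x) (hf : DifferentiableAt ℝ f x) :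
    dirD X (fun y => σ * Real.exp (a y) * Real.exp (f y * b y)) x =
      σ * Real.exp (a x) * Real.exp (f x * b x) *
        (dirD X a x + f x * dirD X b x + b x * dirD X f x) := by
  have hfb : DifferentiableAt ℝ (fun y => f y * b y) x := hf.mul hb
  rw [dirD_mul (u := fun y => σ * Real.exp (a y)) (ha.exp.const_mul σ) hfb.exp,
    dirD_const_mul σ ha.exp, dirD_exp ha, dirD_exp hfb, dirD_mul hf hb]
  ring

/-- The transformed constraint with index `i`. The functions `gi, gj, gk` are permuted cyclically,
and `φi, φj, φk` are the values of the conformal factors. -/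
theorem conf_constraint_algebra {A gi gj gk b φi φj φk cj ck cj' ck' da db dgi dgj dgk dξ : ℝ}
    (hj : φj ≠ 0) (hk : φk ≠ 0) (hg : gj * gk + gk * gi + gi * gj = 0)
    (hdg : gj * dgk + gk * dgj + (gk * dgi + gi * dgk) + (gi * dgj + gj * dgi) = 0)
    (hcon : dgj + dgk + cj * (gi - gj) + ck * (gi - gk) - 2 * dξ * gi = 0)
    (hcj : cj' * φj = φi * φj * cj + φi * (φj * (da + (gk + gi) * db + b * (dgk + dgi))))
    (hck : ck' * φk = φi * φk * ck + φi * (φk * (da + (gi + gj) * db + b * (dgi + dgj)))) :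
    φi * (A * dgj + gj * (A * da) + (A * dgk + gk * (A * da))) + cj' * (A * gi - A * gj)
      + ck' * (A * gi - A * gk)
      - 2 * (φi * (dξ + da + ((gi + gj + gk) * db + b * (dgi + dgj + dgk)))) * (A * gi) = 0 := by
  have hcj : cj' = φi * (cj + (da + (gk + gi) * db + b * (dgk + dgi))) :=
    mul_right_cancel₀ hj (hcj.trans (by ring))
  have hck : ck' = φi * (ck + (da + (gi + gj) * db + b * (dgi + dgj))) :=
    mul_right_cancel₀ hk (hck.trans (by ring))
  subst hcj hck
  linear_combination φi * A * hcon - 2 * φi * A * db * hg - φi * A * b * hdg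

/-- the conformal transformations preserve the BKL constraints. -/
theorem bkl_conformal_transform
    (D : Fin 3 → R3 → R3) (c : Fin 3 → Fin 3 → Fin 3 → R3 → ℝ)
    (g : Fin 3 → R3 → ℝ) (ξ : R3 → ℝ)
    (hD : IsFrame D) (hc : IsStructFns D c) (hgξ : SmoothDatum g ξ)
    (hcon : BKLConstraints D c g ξ)
    (A B : R3 → ℝ) (hA : ContDiff ℝ (⊤ : ℕ∞) A) (hApos : ∀ x : R3, 0 < A x)
    (hB : ContDiff ℝ (⊤ : ℕ∞) B) (hBpos : ∀ x : R3, 0 < B x)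
    (σ : ℝ) (hσ : σ = 1 ∨ σ = -1) :
    IsFrame (confFrame D g A B σ) ∧
    SmoothDatum (fun i x => A x * g i x)
      (fun x => ξ x + Real.log (A x) + (g 0 x + g 1 x + g 2 x) * Real.log (B x)) ∧
    ∀ chat : Fin 3 → Fin 3 → Fin 3 → R3 → ℝ, IsStructFns (confFrame D g A B σ) chat →
      BKLConstraints (confFrame D g A B σ) chat (fun i x => A x * g i x)
        (fun x => ξ x + Real.log (A x) + (g 0 x + g 1 x + g 2 x) * Real.log (B x)) := by
  obtain ⟨hg, hξ⟩ := hgξ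
  have hσ0 : σ ≠ 0 := by rcases hσ with rfl | rfl <;> norm_num
  have ha : ContDiff ℝ (⊤ : ℕ∞) (fun x => Real.log (A x)) := hA.log fun x => (hApos x).ne'
  have hb : ContDiff ℝ (⊤ : ℕ∞) (fun x => Real.log (B x)) := hB.log fun x => (hBpos x).ne'
  set φ : Fin 3 → R3 → ℝ := fun i x =>
    σ * A x * bpow B (fun y => g (i + 1) y + g (i + 2) y) x
  have hφs (i) : ContDiff ℝ (⊤ : ℕ∞) (φ i) :=
    (contDiff_const.mul hA).mul (((hg _).add (hg _)).mul hb).exp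
  have hφ0 (i x) : φ i x ≠ 0 :=
    mul_ne_zero (mul_ne_zero hσ0 (hApos x).ne') (Real.exp_ne_zero _)
  have hframe : confFrame D g A B σ = fun i x => φ i x • D i x := rfl
  refine ⟨⟨fun i => (hφs i).smul (hD.1 i), fun x => ?_⟩, ⟨fun i => hA.mul (hg i),
    (hξ.add ha).add ((((hg 0).add (hg 1)).add (hg 2)).mul hb)⟩, fun chat hchat => ⟨fun x => ?_, ?_⟩⟩
  · exact (hD.2 x).units_smul fun i => Units.mk0 (φ i x) (hφ0 i x)
  · linear_combination A x ^ 2 * hcon.1 x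
  rw [hframe] at hchat ⊢
  have htop : ((⊤ : ℕ∞) : WithTop ℕ∞) ≠ 0 := by simp
  have hgd (i x) : DifferentiableAt ℝ (g i) x := (hg i).differentiable htop x
  have had (x) := ha.differentiable htop x
  have hbd (x) := hb.differentiable htop x
  have hAexp : A = fun x => Real.exp (Real.log (A x)) :=
    funext fun x => (Real.exp_log (hApos x)).symm
  have hdA (X : R3 → R3) (x : R3) : dirD X A x = A x * dirD X (fun y => Real.log (A y)) x := by
    conv_lhs => rw [hAexp]
    rw [dirD_exp (had x), Real.exp_log (hApos x)]
  have hdφ (X : R3 → R3) (i x) : dirD X (φ i) x = φ i x * (dirD X (fun y => Real.log (A y)) x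
      + (g (i + 1) x + g (i + 2) x) * dirD X (fun y => Real.log (B y)) x
      + Real.log (B x) * (dirD X (g (i + 1)) x + dirD X (g (i + 2)) x)) := by
    have h := dirD_conf_factor (X := X) σ (had x) (hbd x) ((hgd (i + 1) x).add (hgd (i + 2) x))
    simp only [Real.exp_log (hApos _)] at h
    rw [← dirD_add (hgd _ x) (hgd _ x)]
    exact h
  have hdquad (X : R3 → R3) (x) : g 1 x * dirD X (g 2) x + g 2 x * dirD X (g 1) x
      + (g 2 x * dirD X (g 0) x + g 0 x * dirD X (g 2) x)
      + (g 0 x * dirD X (g 1) x + g 1 x * dirD X (g 0) x) = 0 := by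
    have hm (i j) : DifferentiableAt ℝ (fun y => g i y * g j y) x := (hgd i x).mul (hgd j x)
    rw [← dirD_mul (hgd _ x) (hgd _ x), ← dirD_mul (hgd _ x) (hgd _ x),
      ← dirD_mul (hgd _ x) (hgd _ x), ← dirD_add (hm _ _) (hm _ _),
      ← dirD_add (u := fun y => g 1 y * g 2 y + g 2 y * g 0 y) ((hm _ _).add (hm _ _)) (hm _ _),
      funext hcon.1]
    simp [dirD]
  have hdAg (X : R3 → R3) (i j x) : dirD X (fun y => A y * g i y + A y * g j y) x =
      A x * dirD X (g i) x + g i x * (A x * dirD X (fun y => Real.log (A y)) x)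
      + (A x * dirD X (g j) x + g j x * (A x * dirD X (fun y => Real.log (A y)) x)) := by
    have hAd : DifferentiableAt ℝ A x := hA.differentiable htop x
    rw [dirD_add (u := fun y => A y * g i y) (v := fun y => A y * g j y)
      (hAd.mul (hgd i x)) (hAd.mul (hgd j x)), dirD_mul hAd (hgd i x), dirD_mul hAd (hgd j x), hdA]
  have hdξ (X : R3 → R3) (x) : dirD X (fun x => ξ x + Real.log (A x)
        + (g 0 x + g 1 x + g 2 x) * Real.log (B x)) x =
      dirD X ξ x + dirD X (fun y => Real.log (A y)) x
      + ((g 0 x + g 1 x + g 2 x) * dirD X (fun y => Real.log (B y)) x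
        + Real.log (B x) * (dirD X (g 0) x + dirD X (g 1) x + dirD X (g 2) x)) := by
    have hξd : DifferentiableAt ℝ ξ x := hξ.differentiable htop x
    have h01 : DifferentiableAt ℝ (fun y => g 0 y + g 1 y) x := (hgd 0 x).add (hgd 1 x)
    have h012 : DifferentiableAt ℝ (fun y => g 0 y + g 1 y + g 2 y) x := h01.add (hgd 2 x)
    rw [dirD_add (u := fun y => ξ y + Real.log (A y))
        (v := fun y => (g 0 y + g 1 y + g 2 y) * Real.log (B y))
        (hξd.add (had x)) (h012.mul (hbd x)),
      dirD_add hξd (had x), dirD_mul h012 (hbd x), dirD_add h01 (hgd 2 x),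
      dirD_add (hgd 0 x) (hgd 1 x)]
  intro i j k hijk x
  have hg0 := hcon.1 x
  have hdq := hdquad (D i) x
  have hcon' := hcon.2 i j k hijk x
  rw [dirD_add (hgd j x) (hgd k x)] at hcon'
  have hij : i ≠ j := by rcases hijk with h | h | h <;> obtain ⟨rfl, rfl, rfl⟩ := h <;> decide
  have hik : i ≠ k := by rcases hijk with h | h | h <;> obtain ⟨rfl, rfl, rfl⟩ := h <;> decide
  have hcj := structFns_smul_diag hD hc (fun i => (hφs i).differentiable htop) hchat hij x
  have hck := structFns_smul_diag hD hc (fun i => (hφs i).differentiable htop) hchat hik x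
  rw [hdφ] at hcj hck
  rw [dirD_smul, dirD_smul, hdAg, hdξ]
  have hjk : j + 1 = k ∧ j + 2 = i ∧ k + 1 = i ∧ k + 2 = j := by
    rcases hijk with h | h | h <;> obtain ⟨rfl, rfl, rfl⟩ := h <;> decide
  obtain ⟨h1, h2, h3, h4⟩ := hjk
  rw [h1, h2] at hcj
  rw [h3, h4] at hck
  have hperm (u : Fin 3 → ℝ) : u 0 + u 1 + u 2 = u i + u j + u k := by
    rcases hijk with h | h | h <;> obtain ⟨rfl, rfl, rfl⟩ := h <;> ring
  rw [hperm fun m => g m x, hperm fun m => dirD (D i) (g m) x]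
  refine conf_constraint_algebra (hφ0 j x) (hφ0 k x) ?_ ?_ hcon' hcj hck
  · rcases hijk with h | h | h <;> obtain ⟨rfl, rfl, rfl⟩ := h <;> linear_combination hg0
  · rcases hijk with h | h | h <;> obtain ⟨rfl, rfl, rfl⟩ := h <;> linear_combination hdq
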